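/- Let Q be a finite set and let E = Q^n be equipped with the Hamming distance. Given a finite nonempty set S ⊆ E, define K_0 = S and inductively K_{i+1} = ⋃_{x, x' ∈ K_i} [x, x']. Then hull(S) = K_{⌈log₂|S|⌉}. -/

import Mathlib

variable {Q : Type*} [Fintype Q] [DecidableEq Q] {n : ℕ}

/-- The metric segment `[x,y]` in the Hamming space `Q^n`. -/
def hammingSeg (x y : Fin n → Q) : Set (Fin n → Q) :=
  {z | hammingDist x y = hammingDist x z + hammingDist z y}

/-- A subset `K ⊆ Q^n` is convex (for the Hamming metric) if it contains the segment
between any two of its points. -/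
def HammingConvex (K : Set (Fin n → Q)) : Prop :=
  ∀ x ∈ K, ∀ y ∈ K, hammingSeg x y ⊆ K

/-- The convex hull of `S ⊆ Q^n`: the smallest Hamming-convex set containing `S`. -/
def hammingHull (S : Set (Fin n → Q)) : Set (Fin n → Q) :=
  ⋂₀ {K : Set (Fin n → Q) | HammingConvex K ∧ S ⊆ K}

/-- One step of the internal construction of the convex hull: to a set `K`,
adjoin all the segments `[x, x']` for `x, x' ∈ K`. -/
def hammingStep (K : Set (Fin n → Q)) : Set (Fin n → Q) :=
  ⋃ x ∈ K, ⋃ x' ∈ K, hammingSeg x x'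

theorem mem_hammingSeg_iff {x y z : Fin n → Q} :
    z ∈ hammingSeg x y ↔ ∀ i, z i = x i ∨ z i = y i := by
  have hle : ∀ i ∈ Finset.univ, (if x i ≠ y i then 1 else 0) ≤
      (if x i ≠ z i then 1 else 0) + (if z i ≠ y i then 1 else 0) := by
    intro i _
    split_ifs <;> simp_all
  simp only [hammingSeg, Set.mem_ofPred_eq, hammingDist, Finset.card_filter]
  rw [← Finset.sum_add_distrib, Finset.sum_eq_sum_iff_of_le hle]
  simp only [Finset.mem_univ, true_implies]
  refine forall_congr' fun i => ?_
  split_ifs <;> grind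

/-- The coordinatewise hull of `S`: all points each of whose coordinates is attained in `S`. -/
def coordinateHull (S : Set (Fin n → Q)) : Set (Fin n → Q) :=
  {z | ∀ i, ∃ s ∈ S, z i = s i}

theorem hammingConvex_coordinateHull (S : Set (Fin n → Q)) :
    HammingConvex (coordinateHull S) := by
  intro x hx y hy z hz i
  rcases mem_hammingSeg_iff.1 hz i with h | h
  · simpa only [h] using hx i
  · simpa only [h] using hy i

theorem hammingHull_subset_coordinateHull (S : Set (Fin n → Q)) :
    hammingHull S ⊆ coordinateHull S :=
  Set.sInter_subset_of_mem
    ⟨hammingConvex_coordinateHull S, fun s hs _ => ⟨s, hs, rfl⟩⟩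

theorem HammingConvex.iterate_hammingStep_subset {S K : Set (Fin n → Q)}
    (hK : HammingConvex K) (hSK : S ⊆ K) (m : ℕ) : hammingStep^[m] S ⊆ K := by
  induction m with
  | zero => exact hSK
  | succ m ih =>
    rw [Function.iterate_succ_apply']
    exact Set.iUnion₂_subset fun x hx => Set.iUnion₂_subset fun y hy => hK x (ih hx) y (ih hy)

theorem iterate_hammingStep_subset_hammingHull (S : Set (Fin n → Q)) (m : ℕ) :
    hammingStep^[m] S ⊆ hammingHull S :=
  Set.subset_sInter fun _ hK => hK.1.iterate_hammingStep_subset hK.2 m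

theorem exists_mem_coordinateHull_agreeing {A : Set (Fin n → Q)} (hA : A.Nonempty)
    (z : Fin n → Q) :
    ∃ x ∈ coordinateHull A, ∀ i, (∃ s ∈ A, z i = s i) → z i = x i := by
  classical
  obtain ⟨a, ha⟩ := hA
  refine ⟨fun i => if ∃ s ∈ A, z i = s i then z i else a i, fun i => ?_, fun i hi => ?_⟩
  · dsimp only
    split_ifs with h
    · exact h
    · exact ⟨a, ha, rfl⟩
  · simp only [if_pos hi]

theorem coordinateHull_union_subset {A B K : Set (Fin n → Q)} (hA : A.Nonempty)
    (hB : B.Nonempty) (hAK : coordinateHull A ⊆ K) (hBK : coordinateHull B ⊆ K) :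
    coordinateHull (A ∪ B) ⊆ hammingStep K := by
  intro z hz
  obtain ⟨x, hx, hxz⟩ := exists_mem_coordinateHull_agreeing hA z
  obtain ⟨y, hy, hyz⟩ := exists_mem_coordinateHull_agreeing hB z
  refine Set.mem_iUnion₂.2 ⟨x, hAK hx, Set.mem_iUnion₂.2 ⟨y, hBK hy, ?_⟩⟩
  refine mem_hammingSeg_iff.2 fun i => ?_
  obtain ⟨s, hs | hs, h⟩ := hz i
  · exact Or.inl (hxz i ⟨s, hs, h⟩)
  · exact Or.inr (hyz i ⟨s, hs, h⟩)

theorem coordinateHull_subset_iterate_hammingStep {K : Set (Fin n → Q)} (m : ℕ)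
    (T : Finset (Fin n → Q)) (hT : T.Nonempty) (hTK : (T : Set (Fin n → Q)) ⊆ K)
    (hcard : T.card ≤ 2 ^ m) :
    coordinateHull (T : Set (Fin n → Q)) ⊆ hammingStep^[m] K := by
  induction m generalizing T with
  | zero =>
    obtain ⟨s, rfl⟩ := Finset.card_eq_one.1 (le_antisymm hcard hT.card_pos)
    intro z hz
    have hzs : z = s := funext fun i => by simpa using hz i
    exact hTK (by simp [hzs])
  | succ m ih =>
    rw [Function.iterate_succ_apply']
    rcases le_or_gt T.card (2 ^ m) with h | h
    · have hsub := ih T hT hTK h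
      simpa using coordinateHull_union_subset hT hT hsub hsub
    · obtain ⟨A, hAT, hA⟩ := Finset.exists_subset_card_eq h.le
      have hB : (T \ A).card = T.card - 2 ^ m := by rw [Finset.card_sdiff_of_subset hAT, hA]
      have hAne : A.Nonempty := Finset.card_pos.1 (by rw [hA]; positivity)
      have hBne : (T \ A).Nonempty := Finset.card_pos.1 (by omega)
      have key := coordinateHull_union_subset hAne hBne
        (ih A hAne ((Finset.coe_subset.2 hAT).trans hTK) hA.le)
        (ih (T \ A) hBne ((Finset.coe_subset.2 Finset.sdiff_subset).trans hTK)
          (by rw [pow_succ] at hcard; omega))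
      rwa [← Finset.coe_union, Finset.union_sdiff_of_subset hAT] at key

/-- For a finite nonempty `S ⊆ Q^n`, setting `K₀ = S` and `K_{i+1} = ⋃_{x,x' ∈ K_i} [x,x']`,
one has `hull(S) = K_{⌈log₂ |S|⌉}`. -/
theorem hammingHull_eq_iterate (S : Finset (Fin n → Q)) (hne : S.Nonempty) :
    hammingHull (↑S : Set (Fin n → Q)) = hammingStep^[Nat.clog 2 S.card] ↑S := by
  refine Set.Subset.antisymm ?_ (iterate_hammingStep_subset_hammingHull _ _)
  exact (hammingHull_subset_coordinateHull _).trans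
    (coordinateHull_subset_iterate_hammingStep _ S hne subset_rfl
      (Nat.le_pow_clog Nat.one_lt_two _))
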